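/- arXiv:math/0102231 — 2 statements merged into one kernel-verified Lean document; each statement's English description precedes it below -/
import Mathlib

section
/- Let k be an algebraically closed field of characteristic different from 2, let φ : M₂(k) → M₂(k) be a bijective k-linear map, and let λ ∈ kˣ be such that det(φ(X)) = λ · det(X) for all X ∈ M₂(k). Then there exist A, B ∈ GL(2,k) such that either φ(X) = A * X * B for all X, in which case the determinant of φ as a linear map on the 4-dimensional space M₂(k) equals λ², or φ(X) = A * Xᵀ * B for all X, in which case the determinant of φ as a linear map equals −λ². (Consequently the similitudes of the form det with trivial similitude norm are exactly the maps X ↦ A X B; this is the identification SGO(4,k) = β(GL(2,k) × GL(2,k)) of (1.6), a subgroup of index 2 in GO(4,k).) -/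
open Matrix

namespace Stmt2Aux

variable {k : Type*} [Field k]

abbrev M (k : Type*) := Matrix (Fin 2) (Fin 2) k

lemma decomp (X : M k) : X = X 0 0 • !![1,0;0,0] + X 0 1 • !![0,1;0,0] + X 1 0 • !![0,0;1,0]
    + X 1 1 • !![0,0;0,1] := by
  ext i j; fin_cases i <;> fin_cases j <;> simp

lemma normal (ψ : M k →ₗ[k] M k) (hdet : ∀ X, (ψ X).det = X.det)
    (h11 : ψ !![1,0;0,0] = !![1,0;0,0]) (h22 : ψ !![0,0;0,1] = !![0,0;0,1]) :
    ∃ D D' : M k, IsUnit D ∧ IsUnit D' ∧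
      ((∀ X, ψ X = D * X * D') ∨ (∀ X, ψ X = D * Xᵀ * D')) := by
  have key : ∀ x y z w : k, (x • !![1,0;0,0] + y • ψ !![0,1;0,0] + z • ψ !![0,0;1,0]
      + w • !![0,0;0,1]).det = x * w - y * z := by
    intro x y z w
    have := hdet !![x,y;z,w]
    rw [decomp !![x,y;z,w]] at this
    simp only [map_add, map_smul, h11, h22] at this
    simpa [det_fin_two] using this
  have hψ : ∀ X, ψ X = X 0 0 • !![1,0;0,0] + X 0 1 • ψ !![0,1;0,0] + X 1 0 • ψ !![0,0;1,0]
      + X 1 1 • !![0,0;0,1] := by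
    intro X
    conv_lhs => rw [decomp X]
    simp only [map_add, map_smul, h11, h22]
  generalize ψ !![0,1;0,0] = N at *
  generalize ψ !![0,0;1,0] = L at *
  simp only [det_fin_two, Matrix.add_apply, Matrix.smul_apply, of_apply, cons_val', cons_val_zero, cons_val_one,
    cons_val_fin_one, smul_eq_mul, mul_one, mul_zero, add_zero, zero_add] at key
  have n0 := key 0 1 0 0
  have n1 := key 1 1 0 0
  have n2 := key 0 1 0 1
  have m0 := key 0 0 1 0
  have m1 := key 1 0 1 0
  have m2 := key 0 0 1 1
  have nm := key 0 1 1 0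
  have a1 : N 1 1 = 0 := by linear_combination n1 - n0
  have a0 : N 0 0 = 0 := by linear_combination n2 - n0
  have b1 : L 1 1 = 0 := by linear_combination m1 - m0
  have b0 : L 0 0 = 0 := by linear_combination m2 - m0
  simp only [a0, a1, b0, b1] at n0 m0 nm
  have n0' : N 0 1 * N 1 0 = 0 := by linear_combination -n0
  have m0' : L 0 1 * L 1 0 = 0 := by linear_combination -m0
  have nm' : N 0 1 * L 1 0 + L 0 1 * N 1 0 = 1 := by linear_combination -nm - n0' - m0'
  rcases mul_eq_zero.1 n0' with h | h
  · have hb : L 0 1 * N 1 0 = 1 := by simpa [h] using nm'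
    have hL : L 0 1 ≠ 0 := left_ne_zero_of_mul_eq_one hb
    have hN : N 1 0 ≠ 0 := right_ne_zero_of_mul_eq_one hb
    have h' : L 1 0 = 0 := by simpa [hL] using m0'
    refine ⟨!![L 0 1, 0; 0, 1], !![N 1 0, 0; 0, 1], ?_, ?_, Or.inr fun X => ?_⟩
    · rw [isUnit_iff_isUnit_det]; simpa [det_fin_two] using hL
    · rw [isUnit_iff_isUnit_det]; simpa [det_fin_two] using hN
    · rw [hψ X]
      ext i j; fin_cases i <;> fin_cases j <;>
        simp [mul_apply, Fin.sum_univ_two, vecMul, dotProduct, hN, hL, h, h', a0, a1, b0, b1] <;>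
        first | ring1 | linear_combination (-X 0 0) * hb
  · have hb : N 0 1 * L 1 0 = 1 := by simpa [h] using nm'
    have hN : N 0 1 ≠ 0 := left_ne_zero_of_mul_eq_one hb
    have hL : L 1 0 ≠ 0 := right_ne_zero_of_mul_eq_one hb
    have h' : L 0 1 = 0 := by simpa [hL] using m0'
    refine ⟨!![N 0 1, 0; 0, 1], !![L 1 0, 0; 0, 1], ?_, ?_, Or.inl fun X => ?_⟩
    · rw [isUnit_iff_isUnit_det]; simpa [det_fin_two] using hN
    · rw [isUnit_iff_isUnit_det]; simpa [det_fin_two] using hL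
    · rw [hψ X]
      ext i j; fin_cases i <;> fin_cases j <;>
        simp [mul_apply, Fin.sum_univ_two, vecMul, dotProduct, hN, hL, h, h', a0, a1, b0, b1] <;>
        first | ring1 | linear_combination (-X 0 0) * hb

lemma diag (e : M k) (ht : e 0 0 + e 1 1 = 1) (hd : e.det = 0) :
    ∃ S : M k, IsUnit S.det ∧ e * S = S * !![1,0;0,0] := by
  rw [det_fin_two] at hd
  by_cases hp : e 0 0 = 0
  · have h1 : e 1 1 = 1 := by simpa [hp] using ht
    have h2 : e 0 1 * e 1 0 = 0 := by simpa [hp] using hd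
    refine ⟨!![e 0 1, 1; 1, -e 1 0], ?_, ?_⟩
    · simp [det_fin_two, h2]
    · ext i j; fin_cases i <;> fin_cases j <;>
        simp [mul_apply, Fin.sum_univ_two, hp, h1] <;>
        have h3 := mul_eq_zero.1 h2 <;> tauto
  · refine ⟨!![e 0 0, -e 0 1; e 1 0, e 0 0], ?_, ?_⟩
    · rw [isUnit_iff_ne_zero]
      have : (!![e 0 0, -e 0 1; e 1 0, e 0 0] : M k).det = e 0 0 := by
        simp [det_fin_two]
        linear_combination (e 0 0) * ht - hd
      rwa [this]
    · ext i j; fin_cases i <;> fin_cases j <;>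
        simp [mul_apply, Fin.sum_univ_two]
      · linear_combination (e 0 0) * ht - hd
      · ring
      · linear_combination (e 1 0) * ht
      · linear_combination hd

lemma form (φ : M k →ₗ[k] M k) (l : kˣ)
    (hdet : ∀ X : M k, (φ X).det = (l : k) * X.det) :
    ∃ A B : M k, IsUnit A ∧ IsUnit B ∧
      ((∀ X, φ X = A * X * B) ∨ (∀ X, φ X = A * Xᵀ * B)) := by
  have hP : IsUnit (φ 1).det := by rw [hdet]; simp
  set P := φ 1 with hPdef
  have hPl : P.det = l := by rw [hPdef, hdet]; simp
  have hPi : P⁻¹.det * l = 1 := by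
    rw [← hPl, ← det_mul, nonsing_inv_mul _ hP, det_one]
  set e := P⁻¹ * φ !![1,0;0,0] with he
  have hed : e.det = 0 := by rw [he, det_mul, hdet]; simp [det_fin_two]
  have hed' : (1 - e).det = 0 := by
    have : 1 - e = P⁻¹ * φ (1 - !![1,0;0,0]) := by
      rw [map_sub, mul_sub, ← hPdef, nonsing_inv_mul _ hP]
    rw [this, det_mul, hdet]; simp [det_fin_two]
  have het : e 0 0 + e 1 1 = 1 := by
    rw [det_fin_two] at hed hed'
    simp at hed'
    linear_combination hed - hed'
  obtain ⟨S, hS, heS⟩ := diag e het hed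
  let ψ : M k →ₗ[k] M k :=
    (LinearMap.mulLeft k (S⁻¹ * P⁻¹)) ∘ₗ (LinearMap.mulRight k S) ∘ₗ φ
  have hψ : ∀ X, ψ X = S⁻¹ * P⁻¹ * (φ X * S) := fun X => rfl
  have h11 : ψ !![1,0;0,0] = !![1,0;0,0] := by
    rw [hψ, Matrix.mul_assoc, ← Matrix.mul_assoc P⁻¹, ← he, heS, ← Matrix.mul_assoc,
      nonsing_inv_mul _ hS, Matrix.one_mul]
  have h1 : ψ 1 = 1 := by
    rw [hψ, ← hPdef, Matrix.mul_assoc, ← Matrix.mul_assoc P⁻¹, nonsing_inv_mul _ hP,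
      Matrix.one_mul, nonsing_inv_mul _ hS]
  have h22 : ψ !![0,0;0,1] = !![0,0;0,1] := by
    have : (!![0,0;0,1] : M k) = 1 - !![1,0;0,0] := by
      ext i j; fin_cases i <;> fin_cases j <;> simp
    rw [this, map_sub, h1, h11]
  have hψd : ∀ X, (ψ X).det = X.det := by
    intro X
    have hSi : S⁻¹.det * S.det = 1 := by rw [← det_mul, nonsing_inv_mul _ hS, det_one]
    rw [hψ, det_mul, det_mul, det_mul, hdet]
    linear_combination (X.det * P⁻¹.det * l) * hSi + X.det * hPi
  have hφψ : ∀ X, φ X = P * S * ψ X * S⁻¹ := by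
    intro X
    rw [hψ]
    simp only [Matrix.mul_assoc]
    rw [mul_nonsing_inv_cancel_left _ _ hS, mul_nonsing_inv_cancel_left _ _ hP, 
      mul_nonsing_inv _ hS, Matrix.mul_one]
  obtain ⟨D, D', hD, hD', h⟩ := normal ψ hψd h11 h22
  have hS1 : IsUnit S := (isUnit_iff_isUnit_det _).2 hS
  have hP1 : IsUnit P := (isUnit_iff_isUnit_det _).2 hP
  have hS2 : IsUnit S⁻¹ := (isUnit_nonsing_inv_iff).2 hS1
  refine ⟨P * S * D, D' * S⁻¹, (hP1.mul hS1).mul hD, hD'.mul hS2, ?_⟩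
  rcases h with h | h
  · left; intro X; rw [hφψ, h]; simp only [Matrix.mul_assoc]
  · right; intro X; rw [hφψ, h]; simp only [Matrix.mul_assoc]

lemma det_formula (φ : M k →ₗ[k] M k) : LinearMap.det φ =
    (Matrix.of fun i j : Fin 4 =>
      (φ (Matrix.single (finProdFinEquiv.symm j : Fin 2 × Fin 2).1
        (finProdFinEquiv.symm j : Fin 2 × Fin 2).2 1))
        (finProdFinEquiv.symm i : Fin 2 × Fin 2).1 (finProdFinEquiv.symm i : Fin 2 × Fin 2).2).det := by
  rw [← LinearMap.det_toMatrix ((Matrix.stdBasis k (Fin 2) (Fin 2)).reindex finProdFinEquiv)]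
  congr 1
  ext i j
  rw [LinearMap.toMatrix_apply]
  have hr : ∀ (Y : M k) (p : Fin 2 × Fin 2),
      (Matrix.stdBasis k (Fin 2) (Fin 2)).repr Y p = Y p.1 p.2 := by
    intro Y p
    simp [Matrix.stdBasis]
  have hs : ∀ p : Fin 2 × Fin 2,
      Matrix.stdBasis k (Fin 2) (Fin 2) p = Matrix.single p.1 p.2 1 := by
    rintro ⟨a, b⟩
    exact Matrix.stdBasis_eq_single _ _ _
  simp only [Module.Basis.reindex_apply, Module.Basis.repr_reindex_apply, hs, hr]
  rfl

lemma det1 (φ : M k →ₗ[k] M k) (A B : M k) (h : ∀ X, φ X = A * X * B) :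
    LinearMap.det φ = (A.det * B.det) ^ 2 := by
  rw [det_formula]
  simp only [h]
  simp [det_succ_row_zero, Fin.sum_univ_succ, mul_apply, single_apply, Fin.succAbove,
    finProdFinEquiv, Fin.divNat, Fin.modNat]
  ring

lemma det2 (φ : M k →ₗ[k] M k) (A B : M k) (h : ∀ X, φ X = A * Xᵀ * B) :
    LinearMap.det φ = -(A.det * B.det) ^ 2 := by
  rw [det_formula]
  simp only [h]
  simp [det_succ_row_zero, Fin.sum_univ_succ, mul_apply, single_apply, Fin.succAbove,
    finProdFinEquiv, Fin.divNat, Fin.modNat]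
  ring

end Stmt2Aux



/-- (1.6): every similitude `φ` of the quadratic form `det` on `M₂(k)` is of the form
`X ↦ A X B` (with linear-map determinant `λ²`, i.e. trivial similitude norm) or
`X ↦ A Xᵀ B` (with linear-map determinant `−λ²`); hence
`SGO(4,k) = β(GL(2,k) × GL(2,k))`, of index 2 in `GO(4,k)`. -/
theorem stmt2 (k : Type*) [Field k] [IsAlgClosed k] (hchar : ringChar k ≠ 2)
    (φ : Matrix (Fin 2) (Fin 2) k →ₗ[k] Matrix (Fin 2) (Fin 2) k)
    (hφ : Function.Bijective φ) (l : kˣ)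
    (hdet : ∀ X : Matrix (Fin 2) (Fin 2) k, (φ X).det = (l : k) * X.det) :
    ∃ A B : Matrix (Fin 2) (Fin 2) k, IsUnit A ∧ IsUnit B ∧
      (((∀ X, φ X = A * X * B) ∧ LinearMap.det φ = (l : k) ^ 2) ∨
        ((∀ X, φ X = A * X.transpose * B) ∧ LinearMap.det φ = -(l : k) ^ 2)) := by
  obtain ⟨A, B, hA, hB, h⟩ := Stmt2Aux.form φ l hdet
  refine ⟨A, B, hA, hB, ?_⟩
  have h1 := hdet 1
  rcases h with h | h
  · refine Or.inl ⟨h, ?_⟩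
    rw [h] at h1
    simp at h1
    rw [Stmt2Aux.det1 φ A B h, h1]
  · refine Or.inr ⟨h, ?_⟩
    rw [h] at h1
    simp at h1
    rw [Stmt2Aux.det2 φ A B h, h1]
end

section
/- Let G be a group and let τ, τ' : G → GL(2,ℂ) be two irreducible representations whose adjoint representations are isomorphic: there is a ℂ-linear bijection φ of the 3-dimensional space sl₂ = {X ∈ M₂(ℂ) : tr X = 0} such that φ(τ(g) X τ(g)⁻¹) = τ'(g) φ(X) τ'(g)⁻¹ for all g ∈ G and all X ∈ sl₂. Then τ' is a one-dimensional twist of τ: there exist a group homomorphism χ : G → ℂˣ and a matrix P ∈ GL(2,ℂ) such that τ'(g) = χ(g) • (P τ(g) P⁻¹) for all g ∈ G. (Theorem 3.10, valid whether or not τ is dihedral; the Galois-theoretic version of multiplicity one for SL(2).) -/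
open Matrix
open scoped MatrixGroups

/-- A representation `τ : G → GL(n,ℂ)` is irreducible if the only subspaces of `ℂⁿ`
invariant under all `τ(g)` are `0` and everything. -/
def IsIrrep {n : Type*} [Fintype n] [DecidableEq n] {G : Type*} [Group G]
    (τ : G →* GL n ℂ) : Prop :=
  ∀ W : Submodule ℂ (n → ℂ),
    (∀ g : G, ∀ v ∈ W, (τ g : Matrix n n ℂ).mulVec v ∈ W) → W = ⊥ ∨ W = ⊤

/-- The 3-dimensional space `sl₂` of trace-zero 2×2 complex matrices. -/
noncomputable def sl2 : Submodule ℂ (Matrix (Fin 2) (Fin 2) ℂ) :=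
  LinearMap.ker (Matrix.traceLinearMap (Fin 2) ℂ ℂ)

/-- The adjoint action of `g ∈ G` on `sl₂` through a 2-dimensional representation `τ`:
`X ↦ τ(g) X τ(g)⁻¹`. -/
noncomputable def adAction {G : Type*} [Group G] (τ : G →* GL (Fin 2) ℂ) (g : G) (X : sl2) : sl2 :=
  ⟨(τ g : Matrix (Fin 2) (Fin 2) ℂ) * (X : Matrix (Fin 2) (Fin 2) ℂ) *
      (((τ g)⁻¹ : GL (Fin 2) ℂ) : Matrix (Fin 2) (Fin 2) ℂ), by
    have hX : Matrix.trace (X : Matrix (Fin 2) (Fin 2) ℂ) = 0 := X.2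
    have key : Matrix.trace ((τ g : Matrix (Fin 2) (Fin 2) ℂ) *
        (X : Matrix (Fin 2) (Fin 2) ℂ) *
        (((τ g)⁻¹ : GL (Fin 2) ℂ) : Matrix (Fin 2) (Fin 2) ℂ))
        = Matrix.trace (X : Matrix (Fin 2) (Fin 2) ℂ) := by
      rw [Matrix.trace_mul_comm, ← mul_assoc]
      have h1 : (((τ g)⁻¹ : GL (Fin 2) ℂ) : Matrix (Fin 2) (Fin 2) ℂ) *
          ((τ g : GL (Fin 2) ℂ) : Matrix (Fin 2) (Fin 2) ℂ) = 1 := Units.inv_mul (τ g)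
      rw [h1, one_mul]
    simpa [sl2, LinearMap.mem_ker] using key.trans hX⟩

lemma sqrt_aux (A : Matrix (Fin 3) (Fin 3) ℂ) (hA : A.det ≠ 0) (hs : Aᵀ = A) :
    ∃ S : Matrix (Fin 3) (Fin 3) ℂ, S * S = A ∧ Sᵀ = S ∧
      ∀ R : Matrix (Fin 3) (Fin 3) ℂ, Commute A R → Commute S R := by
  have hsp : A.charpoly = (A.charpoly.roots.map (fun a => Polynomial.X - Polynomial.C a)).prod :=
    (IsAlgClosed.splits A.charpoly).eq_prod_roots_of_monic A.charpoly_monic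
  have hcard : A.charpoly.roots.card = 3 := by
    rw [← (IsAlgClosed.splits A.charpoly).natDegree_eq_card_roots]; simp
  obtain ⟨a, b, c, habc⟩ := Multiset.card_eq_three.mp hcard
  rw [habc] at hsp
  simp only [Multiset.insert_eq_cons, Multiset.map_cons, Multiset.map_singleton,
    Multiset.prod_cons, Multiset.prod_singleton] at hsp
  have hCH : (A - a • 1) * ((A - b • 1) * (A - c • 1)) = 0 := by
    have h := Matrix.aeval_self_charpoly A
    rw [hsp] at h
    simpa [Algebra.algebraMap_eq_smul_one] using h
  have hev : ∀ t : ℂ, (t • (1 : Matrix (Fin 3) (Fin 3) ℂ) - A).det = (t - a) * ((t - b) * (t - c)) := by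
    intro t
    have h := Matrix.eval_charpoly A t
    rw [hsp] at h
    rw [Matrix.smul_one_eq_diagonal]
    simpa using h.symm
  have h0 : a * (b * c) ≠ 0 := by
    have h := hev 0
    simp [Matrix.det_neg] at h
    intro h'
    apply hA
    linear_combination (-1) * h + (1:ℂ) * h'
  have hsq : ∀ t : ℂ, (t ^ (1/2 : ℂ)) ^ 2 = t := by
    intro t
    simp
  have hne : ∀ s t : ℂ, s ≠ 0 → s ^ (1/2 : ℂ) + t ^ (1/2 : ℂ) ≠ 0 := by
    intro s t hs h
    have h1 : s = t := by
      rw [← hsq s, ← hsq t]; linear_combination h * (s ^ (1/2 : ℂ) - t ^ (1/2 : ℂ))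
    subst h1
    have h2 : s ^ (1/2 : ℂ) = 0 := by linear_combination h / 2
    apply hs; rw [← hsq s, h2]; simp
  have ha : a ≠ 0 := left_ne_zero_of_mul h0
  have hb : b ≠ 0 := left_ne_zero_of_mul (right_ne_zero_of_mul h0)
  have hab := hne a b ha
  have hac := hne a c ha
  have hbc := hne b c hb
  have ea := hsq a
  have eb := hsq b
  have ec := hsq c
  generalize a ^ (1/2 : ℂ) = x at *
  generalize b ^ (1/2 : ℂ) = y at *
  generalize c ^ (1/2 : ℂ) = z at *
  set e1 := x + y + z with he1
  set e2 := x*y + x*z + y*z with he2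
  set e3 := x*y*z with he3
  set U : Matrix (Fin 3) (Fin 3) ℂ := A + e2 • 1 with hU
  set V : Matrix (Fin 3) (Fin 3) ℂ := e1 • A + e3 • 1 with hV
  have hUdet : IsUnit U.det := by
    rw [isUnit_iff_ne_zero]
    have h := hev (-e2)
    have h2 : (-e2) • (1 : Matrix (Fin 3) (Fin 3) ℂ) - A = - U := by rw [hU]; module
    rw [h2, Matrix.det_neg] at h
    have h3 : U.det = ((x+y)*(x+z)*(y+z))^2 := by
      simp only [Fintype.card_fin] at h
      rw [← ea, ← eb, ← ec] at h
      linear_combination (-1) * h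
    rw [h3]
    exact pow_ne_zero _ (mul_ne_zero (mul_ne_zero hab hac) hbc)
  have hUV : V * V = A * (U * U) := by
    rw [← ea, ← eb, ← ec] at hCH
    have : A * (U * U) - V * V = (A - x^2 • 1) * ((A - y^2 • 1) * (A - z^2 • 1)) := by
      rw [hU, hV, he1, he2, he3]
      simp only [mul_add, add_mul, mul_sub, sub_mul, smul_mul_assoc, mul_smul_comm, mul_one, one_mul, smul_add, smul_sub]
      module
    rw [hCH] at this
    exact (sub_eq_zero.mp this).symm
  have hcU : ∀ R, Commute A R → Commute U R := fun R h => by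
    rw [hU]; exact h.add_left ((Commute.one_left R).smul_left _)
  have hcV : ∀ R, Commute A R → Commute V R := fun R h => by
    rw [hV]; exact (h.smul_left _).add_left ((Commute.one_left R).smul_left _)
  have hcUi : ∀ R, Commute U R → Commute U⁻¹ R := fun R h => by
    have h1 := Matrix.nonsing_inv_mul U hUdet
    have h2 := Matrix.mul_nonsing_inv U hUdet
    show U⁻¹ * R = R * U⁻¹
    calc U⁻¹ * R = U⁻¹ * (R * U) * U⁻¹ := by rw [mul_assoc, mul_assoc, h2, mul_one]
      _ = U⁻¹ * (U * R) * U⁻¹ := by rw [h.eq]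
      _ = R * U⁻¹ := by rw [← mul_assoc, h1, one_mul]
  have hUVc : Commute U⁻¹ V := hcUi V (hcU V (hcV A (Commute.refl A)).symm)
  refine ⟨V * U⁻¹, ?_, ?_, ?_⟩
  · have h2 := Matrix.mul_nonsing_inv U hUdet
    calc V * U⁻¹ * (V * U⁻¹) = V * (U⁻¹ * V) * U⁻¹ := by simp only [mul_assoc]
      _ = (V * V) * (U⁻¹ * U⁻¹) := by rw [hUVc.eq]; simp only [mul_assoc]
      _ = A * (U * (U * U⁻¹) * U⁻¹) := by rw [hUV]; simp only [mul_assoc]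
      _ = A := by rw [h2, mul_one, h2, mul_one]
  · have hUt : Uᵀ = U := by rw [hU]; simp [hs]
    have hVt : Vᵀ = V := by rw [hV]; simp [hs]
    rw [Matrix.transpose_mul, Matrix.transpose_nonsing_inv, hUt, hVt, hUVc.eq]
  · intro R h
    exact (hcV R h).mul_left (hcUi R (hcU R h))

noncomputable def pa : (Fin 3 → ℂ) →ₗ[ℂ] Matrix (Fin 2) (Fin 2) ℂ where
  toFun v := !![v 2, v 0 - Complex.I * v 1; v 0 + Complex.I * v 1, - v 2]
  map_add' u v := by
    ext i j; fin_cases i <;> fin_cases j <;> simp <;> ring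
  map_smul' c v := by
    ext i j; fin_cases i <;> fin_cases j <;> simp <;> ring

lemma pa_apply (v : Fin 3 → ℂ) :
    pa v = !![v 2, v 0 - Complex.I * v 1; v 0 + Complex.I * v 1, - v 2] := rfl

noncomputable def co : Matrix (Fin 2) (Fin 2) ℂ →ₗ[ℂ] (Fin 3 → ℂ) where
  toFun X := ![(X 0 1 + X 1 0) / 2, Complex.I * (X 0 1 - X 1 0) / 2, (X 0 0 - X 1 1) / 2]
  map_add' u v := by
    ext i; fin_cases i <;> simp <;> ring
  map_smul' c v := by
    ext i; fin_cases i <;> simp <;> ring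

lemma co_apply (X : Matrix (Fin 2) (Fin 2) ℂ) :
    co X = ![(X 0 1 + X 1 0) / 2, Complex.I * (X 0 1 - X 1 0) / 2, (X 0 0 - X 1 1) / 2] := rfl

lemma co_pa (v : Fin 3 → ℂ) : co (pa v) = v := by
  have hI := Complex.I_mul_I
  ext i; fin_cases i <;> simp [co_apply, pa_apply]
  linear_combination (-v 1) * hI

lemma pa_co (X : Matrix (Fin 2) (Fin 2) ℂ) :
    (X.trace / 2) • (1 : Matrix (Fin 2) (Fin 2) ℂ) + pa (co X) = X := by
  have hI := Complex.I_mul_I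
  ext i j; fin_cases i <;> fin_cases j <;> simp [co_apply, pa_apply, Matrix.trace_fin_two]
  · ring
  · linear_combination (-(X 0 1 - X 1 0)/2) * hI
  · linear_combination ((X 0 1 - X 1 0)/2) * hI
  · ring

lemma pa_trace (v : Fin 3 → ℂ) : (pa v).trace = 0 := by
  simp [pa_apply, Matrix.trace_fin_two]

lemma pa_mul (u v : Fin 3 → ℂ) :
    pa u * pa v = (u ⬝ᵥ v) • (1 : Matrix (Fin 2) (Fin 2) ℂ) + Complex.I • pa (crossProduct u v) := by
  have hI := Complex.I_mul_I
  ext i j; fin_cases i <;> fin_cases j <;>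
    simp [pa_apply, cross_apply, Matrix.mul_apply, Fin.sum_univ_succ, dotProduct]
  · linear_combination (-u 1 * v 1) * hI
  · linear_combination (u 2 * v 0 - u 0 * v 2) * hI
  · linear_combination (-u 2 * v 0 + u 0 * v 2) * hI
  · linear_combination (-u 1 * v 1) * hI

lemma cross_orth (O : Matrix (Fin 3) (Fin 3) ℂ) (h : Oᵀ * O = 1) (hd : O.det = 1)
    (u v : Fin 3 → ℂ) : crossProduct (O *ᵥ u) (O *ᵥ v) = O *ᵥ crossProduct u v := by
  have hadj : O.adjugate = Oᵀ := by
    have h1 := Matrix.mul_adjugate O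
    rw [hd, one_smul] at h1
    calc O.adjugate = (Oᵀ * O) * O.adjugate := by rw [h, one_mul]
      _ = Oᵀ := by rw [mul_assoc, h1, mul_one]
  have hO : O = O.adjugateᵀ := by rw [hadj, transpose_transpose]
  have key : crossProduct (O *ᵥ u) (O *ᵥ v) = O.adjugateᵀ *ᵥ crossProduct u v := by
    ext i; fin_cases i <;>
      simp [cross_apply, Matrix.adjugate_fin_three, Matrix.mulVec, dotProduct, Fin.sum_univ_succ] <;> ring
  rw [key, ← hO]

lemma dot_orth (O : Matrix (Fin 3) (Fin 3) ℂ) (h : Oᵀ * O = 1)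
    (u v : Fin 3 → ℂ) : (O *ᵥ u) ⬝ᵥ (O *ᵥ v) = u ⬝ᵥ v := by
  rw [Matrix.dotProduct_mulVec, Matrix.vecMul_mulVec, h, Matrix.vecMul_one]

lemma matrix_aut (f : Matrix (Fin 2) (Fin 2) ℂ →ₐ[ℂ] Matrix (Fin 2) (Fin 2) ℂ) :
    ∃ P : GL (Fin 2) ℂ, ∀ X, f X = (P : Matrix (Fin 2) (Fin 2) ℂ) * X *
      ((P⁻¹ : GL (Fin 2) ℂ) : Matrix (Fin 2) (Fin 2) ℂ) := by
  have hinj : Function.Injective f := RingHom.injective f.toRingHom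
  have hsurj : Function.Surjective f := 
    (LinearMap.injective_iff_surjective (f := f.toLinearMap)).mp hinj
  let e := AlgEquiv.ofBijective f ⟨hinj, hsurj⟩
  let t := Matrix.toLinAlgEquiv' (R := ℂ) (n := Fin 2)
  obtain ⟨T, hT⟩ := AlgEquiv.eq_linearEquivConjAlgEquiv ((t.symm.trans e).trans t)
  let P : GL (Fin 2) ℂ :=
    ⟨LinearMap.toMatrix' (T : (Fin 2 → ℂ) →ₗ[ℂ] (Fin 2 → ℂ)),
     LinearMap.toMatrix' (T.symm : (Fin 2 → ℂ) →ₗ[ℂ] (Fin 2 → ℂ)),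
     by rw [← LinearMap.toMatrix'_comp]; simp, by rw [← LinearMap.toMatrix'_comp]; simp⟩
  refine ⟨P, fun X => ?_⟩
  have h := congrArg (fun k => k (t X)) hT
  simp only [AlgEquiv.trans_apply, AlgEquiv.symm_apply_apply, LinearEquiv.conjAlgEquiv_apply] at h
  have h2 : f X = t.symm (t (e X)) := by
    rw [AlgEquiv.symm_apply_apply]; rfl
  rw [h2, h]
  have h4 : ∀ k, t.symm k = LinearMap.toMatrix' k := fun k => rfl
  have h5 : P.val = LinearMap.toMatrix' (T : (Fin 2 → ℂ) →ₗ[ℂ] (Fin 2 → ℂ)) := rfl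
  have h6 : (P⁻¹).val = LinearMap.toMatrix' (T.symm : (Fin 2 → ℂ) →ₗ[ℂ] (Fin 2 → ℂ)) := rfl
  rw [h4, h5, h6]
  rw [LinearMap.toMatrix'_comp, LinearMap.toMatrix'_comp]
  have h3 : LinearMap.toMatrix' (t X) = X := LinearMap.toMatrix'_toLin' X
  rw [h3, mul_assoc]

lemma so3_lift (O : Matrix (Fin 3) (Fin 3) ℂ) (h : Oᵀ * O = 1) (hd : O.det = 1) :
    ∃ P : GL (Fin 2) ℂ, ∀ v, pa (O *ᵥ v) = (P : Matrix (Fin 2) (Fin 2) ℂ) * pa v *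
      ((P⁻¹ : GL (Fin 2) ℂ) : Matrix (Fin 2) (Fin 2) ℂ) := by
  let ψ : Matrix (Fin 2) (Fin 2) ℂ →ₗ[ℂ] Matrix (Fin 2) (Fin 2) ℂ :=
    (LinearMap.toSpanSingleton ℂ _ (1 : Matrix (Fin 2) (Fin 2) ℂ)) ∘ₗ
      ((1/2 : ℂ) • Matrix.traceLinearMap (Fin 2) ℂ ℂ) + pa ∘ₗ O.mulVecLin ∘ₗ co
  have hψ0 : ∀ X, ψ X = (X.trace / 2) • (1 : Matrix (Fin 2) (Fin 2) ℂ) + pa (O *ᵥ co X) := by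
    intro X; simp [ψ, div_eq_inv_mul]
  have hco1 : co 1 = 0 := by ext i; fin_cases i <;> simp [co_apply]
  have hψ : ∀ (s : ℂ) (u : Fin 3 → ℂ),
      ψ (s • 1 + pa u) = s • (1 : Matrix (Fin 2) (Fin 2) ℂ) + pa (O *ᵥ u) := by
    intro s u
    rw [hψ0, map_add, map_smul, hco1, co_pa, Matrix.trace_add, Matrix.trace_smul, pa_trace]
    simp
  have h1 : ψ 1 = 1 := by
    have := hψ 1 0
    simpa using this
  have hform : ∀ (s t : ℂ) (u v : Fin 3 → ℂ),
      (s • (1 : Matrix (Fin 2) (Fin 2) ℂ) + pa u) * (t • 1 + pa v) =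
        (s * t + u ⬝ᵥ v) • 1 + pa (s • v + t • u + Complex.I • crossProduct u v) := by
    intro s t u v
    simp only [mul_add, add_mul, smul_mul_assoc, mul_smul_comm, mul_one, one_mul, pa_mul,
      map_add, map_smul]
    module
  have hmul : ∀ X Y, ψ (X * Y) = ψ X * ψ Y := by
    intro X Y
    rw [← pa_co X, ← pa_co Y]
    rw [hform, hψ, hψ, hψ, hform, dot_orth O h, cross_orth O h hd]
    simp only [Matrix.mulVec_add, Matrix.mulVec_smul]
  obtain ⟨P, hP⟩ := matrix_aut (AlgHom.ofLinearMap ψ h1 hmul)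
  refine ⟨P, fun v => ?_⟩
  rw [← hP (pa v)]
  have := hψ 0 v
  simpa using this.symm

lemma conj_orth (A : GL (Fin 2) ℂ) : ∃ R : Matrix (Fin 3) (Fin 3) ℂ, Rᵀ * R = 1 ∧
    ∀ v, pa (R *ᵥ v) = (A : Matrix (Fin 2) (Fin 2) ℂ) * pa v *
      ((A⁻¹ : GL (Fin 2) ℂ) : Matrix (Fin 2) (Fin 2) ℂ) := by
  have hA : ((A⁻¹ : GL (Fin 2) ℂ) : Matrix (Fin 2) (Fin 2) ℂ) * (A : Matrix (Fin 2) (Fin 2) ℂ) = 1 :=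
    Units.inv_mul A
  generalize hB : ((A⁻¹ : GL (Fin 2) ℂ) : Matrix (Fin 2) (Fin 2) ℂ) = B at *
  generalize hA' : (A : Matrix (Fin 2) (Fin 2) ℂ) = A' at *
  have htr : ∀ X : Matrix (Fin 2) (Fin 2) ℂ, (A' * X * B).trace = X.trace := by
    intro X
    rw [Matrix.trace_mul_comm, ← mul_assoc, hA, one_mul]
  let R := LinearMap.toMatrix' (co ∘ₗ LinearMap.mulRight ℂ B ∘ₗ LinearMap.mulLeft ℂ A' ∘ₗ pa)
  have hR : ∀ v, pa (R *ᵥ v) = A' * pa v * B := by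
    intro v
    have h1 : R *ᵥ v = co (A' * pa v * B) := by
      simp only [R, LinearMap.toMatrix'_mulVec]; rfl
    have h2 := pa_co (A' * pa v * B)
    rw [htr, pa_trace] at h2
    rw [h1]; simpa using h2
  refine ⟨R, ?_, hR⟩
  have htd : ∀ u v, (pa u * pa v).trace = 2 * (u ⬝ᵥ v) := by
    intro u v
    rw [pa_mul, Matrix.trace_add, Matrix.trace_smul, Matrix.trace_smul, pa_trace]
    simp [mul_comm]
  have hd : ∀ u v, (R *ᵥ u) ⬝ᵥ (R *ᵥ v) = u ⬝ᵥ v := by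
    intro u v
    have h1 := htd (R *ᵥ u) (R *ᵥ v)
    have h2 : A' * pa u * B * (A' * pa v * B) = A' * (pa u * pa v) * B := by
      calc _ = A' * pa u * (B * A') * pa v * B := by simp only [mul_assoc]
        _ = _ := by rw [hA, mul_one]; simp only [mul_assoc]
    rw [hR, hR, h2, htr, htd] at h1
    exact (mul_left_cancel₀ two_ne_zero h1).symm
  ext i j
  have h := hd (Pi.single i 1) (Pi.single j 1)
  rw [Matrix.dotProduct_mulVec, Matrix.vecMul_mulVec, ← Matrix.dotProduct_mulVec] at h
  simpa [Matrix.one_apply, Pi.single_apply, eq_comm (a := j) (b := i)] using h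

lemma pa_inj : Function.Injective pa := fun u v h => by
  rw [← co_pa u, ← co_pa v, h]

lemma central_scalar (M : Matrix (Fin 2) (Fin 2) ℂ) (h : ∀ v, M * pa v = pa v * M) :
    ∃ c : ℂ, M = c • 1 := by
  refine ⟨M 0 0, ?_⟩
  have h1 := h ![1, 0, 0]
  have h2 := h ![0, 0, 1]
  have a1 := congrFun (congrFun h1 0) 1
  have a2 := congrFun (congrFun h2 0) 1
  have a3 := congrFun (congrFun h2 1) 0
  simp [pa_apply, Matrix.mul_apply, Fin.sum_univ_succ] at a1 a2 a3
  ext i j; fin_cases i <;> fin_cases j <;> simp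
  · linear_combination (-1/2) * a2
  · linear_combination (1/2) * a3
  · exact a1.symm

/-- **Theorem 3.10** (multiplicity one for SL(2), Galois version): two irreducible
2-dimensional representations of a group `G` with isomorphic adjoint representations
are twists of each other by a character. -/
theorem stmt4 {G : Type*} [Group G] (τ τ' : G →* GL (Fin 2) ℂ)
    (hτ : IsIrrep τ) (hτ' : IsIrrep τ')
    (φ : sl2 →ₗ[ℂ] sl2) (hφ : Function.Bijective φ)
    (hequiv : ∀ (g : G) (X : sl2), φ (adAction τ g X) = adAction τ' g (φ X)) :
    ∃ (χ : G →* ℂˣ) (P : GL (Fin 2) ℂ), ∀ g : G,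
      (τ' g : Matrix (Fin 2) (Fin 2) ℂ)
        = (χ g : ℂ) • ((P : Matrix (Fin 2) (Fin 2) ℂ) * (τ g : Matrix (Fin 2) (Fin 2) ℂ) *
            ((P⁻¹ : GL (Fin 2) ℂ) : Matrix (Fin 2) (Fin 2) ℂ)) := by
  have hmem : ∀ v, pa v ∈ sl2 := fun v => pa_trace v
  have hback : ∀ X : sl2, pa (co (X : Matrix (Fin 2) (Fin 2) ℂ)) = X := by
    intro X
    have h := pa_co (X : Matrix (Fin 2) (Fin 2) ℂ)
    have hX : Matrix.trace (X : Matrix (Fin 2) (Fin 2) ℂ) = 0 := X.2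
    rw [hX] at h
    simpa using h
  let F := LinearMap.toMatrix' (co ∘ₗ sl2.subtype ∘ₗ φ ∘ₗ pa.codRestrict sl2 hmem)
  have hF : ∀ v, pa (F *ᵥ v) = φ ⟨pa v, hmem v⟩ := by
    intro v
    have h1 : F *ᵥ v = co (φ ⟨pa v, hmem v⟩ : Matrix (Fin 2) (Fin 2) ℂ) := by
      simp only [F, LinearMap.toMatrix'_mulVec]; rfl
    rw [h1, hback]
  choose R hRo hR using fun g => conj_orth (τ g)
  choose R' hRo' hR' using fun g => conj_orth (τ' g)
  have hFR : ∀ g, F * R g = R' g * F := by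
    intro g
    apply Matrix.ext_of_mulVec_single
    intro i
    generalize (Pi.single i 1 : Fin 3 → ℂ) = v
    apply pa_inj
    rw [← Matrix.mulVec_mulVec, ← Matrix.mulVec_mulVec, hF, hR', hF]
    have h := congrArg Subtype.val (hequiv g ⟨pa v, hmem v⟩)
    have h2 : (⟨pa (R g *ᵥ v), hmem _⟩ : sl2) = adAction τ g ⟨pa v, hmem v⟩ :=
      Subtype.ext (hR g v)
    rw [h2, h]
    rfl
  have hFinj : Function.Injective F.mulVec := by
    intro u v h
    have h1 : φ ⟨pa u, hmem u⟩ = φ ⟨pa v, hmem v⟩ := Subtype.ext (by rw [← hF, ← hF, h])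
    exact pa_inj (congrArg Subtype.val (hφ.1 h1))
  have hFdet : F.det ≠ 0 := by
    have := Matrix.mulVec_injective_iff_isUnit.mp hFinj
    exact ((Matrix.isUnit_iff_isUnit_det F).mp this).ne_zero
  have hRo2 : ∀ g, R g * (R g)ᵀ = 1 := fun g => mul_eq_one_comm.mp (hRo g)
  obtain ⟨S, hSS, hSt, hSc⟩ := sqrt_aux (Fᵀ * F) (by simpa using hFdet) (by simp)
  have hSR : ∀ g, S * R g = R g * S := by
    intro g
    apply (hSc (R g) _).eq
    have h1 : (R g)ᵀ * (Fᵀ * F) * R g = Fᵀ * F := by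
      calc (R g)ᵀ * (Fᵀ * F) * R g = (F * R g)ᵀ * (F * R g) := by
            rw [Matrix.transpose_mul]; simp only [mul_assoc]
        _ = Fᵀ * ((R' g)ᵀ * R' g) * F := by
            rw [hFR, Matrix.transpose_mul]; simp only [mul_assoc]
        _ = Fᵀ * F := by rw [hRo', mul_one]
    calc Fᵀ * F * R g = (R g * (R g)ᵀ) * (Fᵀ * F) * R g := by rw [hRo2, one_mul]
      _ = R g * ((R g)ᵀ * (Fᵀ * F) * R g) := by simp only [mul_assoc]
      _ = R g * (Fᵀ * F) := by rw [h1]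
  have hSdet : IsUnit S.det := by
    rw [isUnit_iff_ne_zero]
    intro h
    have := congrArg Matrix.det hSS
    rw [Matrix.det_mul, h, Matrix.det_mul, Matrix.det_transpose] at this
    apply hFdet
    simpa using this.symm
  have hS1 := Matrix.mul_nonsing_inv S hSdet
  have hS2 := Matrix.nonsing_inv_mul S hSdet
  have hO : ∃ O : Matrix (Fin 3) (Fin 3) ℂ, Oᵀ * O = 1 ∧ O.det = 1 ∧
      ∀ g, O * R g = R' g * O := by
    have ho : (F * S⁻¹)ᵀ * (F * S⁻¹) = 1 := by
      rw [Matrix.transpose_mul, Matrix.transpose_nonsing_inv, hSt]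
      calc S⁻¹ * Fᵀ * (F * S⁻¹) = S⁻¹ * (Fᵀ * F) * S⁻¹ := by simp only [mul_assoc]
        _ = (S⁻¹ * S) * (S * S⁻¹) := by rw [← hSS]; simp only [mul_assoc]
        _ = 1 := by rw [hS1, hS2, one_mul]
    have hc : ∀ g, (F * S⁻¹) * R g = R' g * (F * S⁻¹) := by
      intro g
      have h1 : S⁻¹ * R g = R g * S⁻¹ := by
        calc S⁻¹ * R g = S⁻¹ * (R g * S) * S⁻¹ := by rw [mul_assoc, mul_assoc, hS1, mul_one]
          _ = (S⁻¹ * S) * R g * S⁻¹ := by rw [← hSR]; simp only [mul_assoc]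
          _ = R g * S⁻¹ := by rw [hS2, one_mul]
      rw [mul_assoc, h1, ← mul_assoc, hFR, mul_assoc]
    have hdd : (F * S⁻¹).det * (F * S⁻¹).det = 1 := by
      have := congrArg Matrix.det ho
      rwa [Matrix.det_mul, Matrix.det_transpose, Matrix.det_one] at this
    rcases mul_self_eq_one_iff.mp hdd with h | h
    · exact ⟨F * S⁻¹, ho, h, hc⟩
    · refine ⟨-(F * S⁻¹), ?_, ?_, ?_⟩
      · rw [Matrix.transpose_neg, neg_mul_neg, ho]
      · rw [Matrix.det_neg, h]; norm_num
      · intro g; rw [neg_mul, mul_neg, hc]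
  obtain ⟨O, hOo, hOd, hOc⟩ := hO
  obtain ⟨P, hP⟩ := so3_lift O hOo hOd
  have key : ∀ g, ∃ c : ℂˣ, (τ' g : Matrix (Fin 2) (Fin 2) ℂ) =
      (c : ℂ) • ((P * τ g * P⁻¹ : GL (Fin 2) ℂ) : Matrix (Fin 2) (Fin 2) ℂ) := by
    intro g
    let Q : GL (Fin 2) ℂ := (τ' g)⁻¹ * (P * τ g * P⁻¹)
    have hconj : ∀ w, (P * τ g * P⁻¹ : GL (Fin 2) ℂ).val * pa w =
        (τ' g).val * pa w * (τ' g)⁻¹.val * (P * τ g * P⁻¹ : GL (Fin 2) ℂ).val := by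
      intro w
      obtain ⟨v, rfl⟩ : ∃ v, O *ᵥ v = w :=
        ⟨Oᵀ *ᵥ w, by rw [Matrix.mulVec_mulVec, mul_eq_one_comm.mp hOo, Matrix.one_mulVec]⟩
      have h1 : pa (O *ᵥ (R g *ᵥ v)) = pa (R' g *ᵥ (O *ᵥ v)) := by
        rw [Matrix.mulVec_mulVec, Matrix.mulVec_mulVec, hOc]
      rw [hR', hP, hR] at h1
      rw [← h1, hP]
      have e1 : (P⁻¹).val * P.val = 1 := Units.inv_mul P
      have e2 : ((τ g)⁻¹).val * (τ g).val = 1 := Units.inv_mul (τ g)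
      simp only [Units.val_mul]
      calc P.val * (τ g).val * (P⁻¹).val * (P.val * pa v * (P⁻¹).val)
          = P.val * (τ g).val * ((P⁻¹).val * P.val) * pa v * (P⁻¹).val := by
            simp only [mul_assoc]
        _ = P.val * (τ g).val * pa v * (((τ g)⁻¹).val * ((P⁻¹).val * P.val) * (τ g).val)
              * (P⁻¹).val := by rw [e1, mul_one, mul_one, e2, mul_one]
        _ = _ := by simp only [mul_assoc]
    have hQ : ∀ w, Q.val * pa w = pa w * Q.val := by
      intro w
      have e2 : ((τ' g)⁻¹).val * (τ' g).val = 1 := Units.inv_mul (τ' g)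
      simp only [Q, Units.val_mul (τ' g)⁻¹]
      rw [mul_assoc, hconj]
      calc _ = (((τ' g)⁻¹).val * (τ' g).val) * (pa w * (((τ' g)⁻¹).val *
            (P * τ g * P⁻¹ : GL (Fin 2) ℂ).val)) := by simp only [mul_assoc]
        _ = _ := by rw [e2, one_mul]
    obtain ⟨c, hc⟩ := central_scalar Q.val hQ
    have hc0 : c ≠ 0 := by
      rintro rfl
      rw [zero_smul] at hc
      exact Q.ne_zero hc
    have h3 : (P * τ g * P⁻¹ : GL (Fin 2) ℂ) = τ' g * Q := by simp [Q]
    refine ⟨(Units.mk0 c hc0)⁻¹, ?_⟩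
    rw [h3, Units.val_mul, hc]
    simp [smul_smul, hc0]
  choose χ hχ using key
  have hinj : ∀ (c d : ℂˣ) (M : GL (Fin 2) ℂ), (c : ℂ) • M.val = (d : ℂ) • M.val → c = d := by
    intro c d M h
    exact Units.ext (smul_left_injective ℂ M.ne_zero h)
  refine ⟨MonoidHom.mk' χ ?_, P, ?_⟩
  · intro a b
    apply hinj _ _ (P * τ (a * b) * P⁻¹)
    rw [← hχ, map_mul τ', Units.val_mul, hχ a, hχ b, smul_mul_smul_comm, ← Units.val_mul,
      ← Units.val_mul]
    congr 2
    rw [map_mul]; group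
  · intro g
    rw [hχ g]
    rfl
end
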